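/- Let g be an isometry of a δ-hyperbolic geodesic metric space X (with δ > 0). Then the set M(g) = X(g, min(g) + 1000δ) = {x ∈ X : d(g(x), x) ≤ min(g) + 1000δ} is nonempty, g-invariant, and 100δ-quasi-convex. -/

import Mathlib

def IsGeodesicFrom {X : Type} [MetricSpace X] (x y : X) (γ : ℝ → X) : Prop :=
  γ 0 = x ∧ γ (dist x y) = y ∧
    ∀ s ∈ Set.Icc (0 : ℝ) (dist x y), ∀ t ∈ Set.Icc (0 : ℝ) (dist x y),
      dist (γ s) (γ t) = |s - t|

def geoImage {X : Type} [MetricSpace X] (x y : X) (γ : ℝ → X) : Set X :=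
  γ '' Set.Icc (0 : ℝ) (dist x y)

def IsGeodesicSpace (X : Type) [MetricSpace X] : Prop :=
  ∀ x y : X, ∃ γ : ℝ → X, IsGeodesicFrom x y γ

def IsDeltaHyperbolic (X : Type) [MetricSpace X] (δ : ℝ) : Prop :=
  ∀ (x y z : X) (γ₁ γ₂ γ₃ : ℝ → X),
    IsGeodesicFrom x y γ₁ → IsGeodesicFrom y z γ₂ → IsGeodesicFrom x z γ₃ →
      ∀ p ∈ geoImage x z γ₃,
        ∃ q ∈ geoImage x y γ₁ ∪ geoImage y z γ₂, dist p q ≤ δ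

def QuasiConvexSet {X : Type} [MetricSpace X] (Q : ℝ) (A : Set X) : Prop :=
  ∀ x ∈ A, ∀ y ∈ A, ∀ γ : ℝ → X, IsGeodesicFrom x y γ →
    ∀ p ∈ geoImage x y γ, ∃ a ∈ A, dist p a ≤ Q


/-- The minimal translation length of an isometry `g`: `inf_p d(p, g p)`. -/
noncomputable def minTrans {X : Type} [MetricSpace X] (g : X ≃ᵢ X) : ℝ :=
  ⨅ p : X, dist p (g p)

/-- The coarse minimizing set `M(g) = X(g, min(g) + 1000δ)`. -/
noncomputable def minSet {X : Type} [MetricSpace X] (δ : ℝ) (g : X ≃ᵢ X) : Set X :=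
  {x : X | dist (g x) x ≤ minTrans g + 1000 * δ}

theorem geo_add {X : Type} [MetricSpace X] {x y : X} {γ : ℝ → X} (h : IsGeodesicFrom x y γ)
    {u : X} (hu : u ∈ geoImage x y γ) : dist x u + dist u y = dist x y := by
  obtain ⟨t, ht, rfl⟩ := hu
  obtain ⟨h0, h1, h2⟩ := h
  have e0 := h2 0 ⟨le_refl _, dist_nonneg⟩ t ht
  have e1 := h2 t ht (dist x y) ⟨dist_nonneg, le_refl _⟩
  rw [h0] at e0
  rw [h1] at e1
  rw [e0, e1, abs_of_nonpos (by linarith [ht.1]), abs_of_nonpos (by linarith [ht.2])]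
  ring

theorem geo_dist {X : Type} [MetricSpace X] {x y : X} {γ : ℝ → X} (h : IsGeodesicFrom x y γ)
    {u v : X} (hu : u ∈ geoImage x y γ) (hv : v ∈ geoImage x y γ) :
    dist u v = |dist x u - dist x v| := by
  obtain ⟨t, ht, rfl⟩ := hu
  obtain ⟨s, hs, rfl⟩ := hv
  obtain ⟨h0, h1, h2⟩ := h
  have e0 := h2 0 ⟨le_refl _, dist_nonneg⟩ t ht
  have e1 := h2 0 ⟨le_refl _, dist_nonneg⟩ s hs
  rw [h0] at e0 e1
  rw [zero_sub, abs_neg, abs_of_nonneg ht.1] at e0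
  rw [zero_sub, abs_neg, abs_of_nonneg hs.1] at e1
  rw [h2 t ht s hs, e0, e1]

theorem geo_rev {X : Type} [MetricSpace X] {x y : X} {γ : ℝ → X} (h : IsGeodesicFrom x y γ) :
    ∃ γ' : ℝ → X, IsGeodesicFrom y x γ' ∧ geoImage y x γ' ⊆ geoImage x y γ := by
  obtain ⟨h0, h1, h2⟩ := h
  refine ⟨fun t => γ (dist x y - t), ⟨by simpa using h1, by simpa [dist_comm y x] using h0, ?_⟩, ?_⟩
  · intro s hs t ht
    rw [dist_comm y x] at hs ht
    rw [h2 _ ⟨by linarith [hs.2], by linarith [hs.1]⟩ _ ⟨by linarith [ht.2], by linarith [ht.1]⟩,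
      abs_sub_comm]
    congr 1
    ring
  · rintro _ ⟨t, ht, rfl⟩
    rw [dist_comm y x] at ht
    exact ⟨dist x y - t, ⟨by linarith [ht.2], by linarith [ht.1]⟩, rfl⟩

theorem geo_map {X : Type} [MetricSpace X] (g : X ≃ᵢ X) {x y : X} {γ : ℝ → X}
    (h : IsGeodesicFrom x y γ) : IsGeodesicFrom (g x) (g y) (fun t => g (γ t)) := by
  obtain ⟨h0, h1, h2⟩ := h
  refine ⟨by simp [h0], by rw [g.dist_eq]; exact congrArg g h1, ?_⟩
  intro s hs t ht
  rw [g.dist_eq] at hs ht ⊢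
  exact h2 s hs t ht

theorem geo_map_mem {X : Type} [MetricSpace X] (g : X ≃ᵢ X) {x y : X} {γ : ℝ → X} {u : X}
    (h : u ∈ geoImage x y γ) : g u ∈ geoImage (g x) (g y) (fun t => g (γ t)) := by
  obtain ⟨t, ht, rfl⟩ := h
  exact ⟨t, by rwa [g.dist_eq], rfl⟩

theorem geo_map_mem_inv {X : Type} [MetricSpace X] (g : X ≃ᵢ X) {x y : X} {γ : ℝ → X} {u : X}
    (h : u ∈ geoImage (g x) (g y) (fun t => g (γ t))) : ∃ v ∈ geoImage x y γ, u = g v := by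
  obtain ⟨t, ht, rfl⟩ := h
  rw [g.dist_eq] at ht
  exact ⟨γ t, ⟨t, ht, rfl⟩, rfl⟩

/-- The displacement function is coarsely quasi-convex along geodesics. -/
theorem disp_quasiconvex {X : Type} [MetricSpace X] (δ : ℝ) (hδ : 0 < δ)
    (hgeo : IsGeodesicSpace X) (hhyp : IsDeltaHyperbolic X δ) (g : X ≃ᵢ X) {x y p : X} {L : ℝ}
    (hx : dist (g x) x ≤ L) (hy : dist (g y) y ≤ L) {γ : ℝ → X} (hγ : IsGeodesicFrom x y γ)
    (hp : p ∈ geoImage x y γ) : dist (g p) p ≤ L + 4 * δ := by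
  obtain ⟨a, ha⟩ := hgeo x (g x)
  obtain ⟨b, hb⟩ := hgeo (g x) y
  obtain ⟨c, hc⟩ := hgeo (g y) y
  have hpa := geo_add hγ hp
  have key : ∀ u, dist p u ≤ 2 * δ → (u ∈ geoImage x (g x) a ∨
      u ∈ geoImage (g x) (g y) (fun t => g (γ t)) ∨ u ∈ geoImage (g y) y c) →
      dist (g p) p ≤ L + 4 * δ := by
    rintro u hpu (hu | hu | hu)
    · have h1 := geo_add ha hu
      have h2 := dist_triangle x u p
      have h3 := dist_triangle4 (g p) (g x) u p
      rw [g.dist_eq] at h3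
      rw [dist_comm x (g x)] at h1
      rw [dist_comm p u] at hpu
      rw [dist_comm p x] at h3
      rw [dist_comm (g x) u] at h3
      linarith
    · obtain ⟨v, hv, rfl⟩ := geo_map_mem_inv g hu
      have h1 := geo_dist hγ hp hv
      have h2 := dist_triangle4 (g x) x p (g v)
      have h3 := dist_triangle4 x (g x) (g v) p
      rw [g.dist_eq] at h2 h3
      have h4 := dist_triangle (g p) (g v) p
      rw [g.dist_eq] at h4
      rw [dist_comm (g v) p] at h3 h4
      rw [dist_comm x (g x)] at h3
      have h5 : dist p v ≤ L + 2 * δ := by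
        rw [h1, abs_le]
        constructor <;> linarith
      linarith
    · have h1 := geo_add hc hu
      have h2 := dist_triangle p u y
      have h3 := dist_triangle4 (g p) (g y) u p
      rw [g.dist_eq, dist_comm u p] at h3
      linarith
  obtain ⟨q, hq, hpq⟩ := hhyp x (g x) y a b γ ha hb hγ p hp
  rcases hq with hq | hq
  · exact key q (by linarith) (Or.inl hq)
  · obtain ⟨u, hu, hqu⟩ := hhyp (g x) (g y) y _ c b (geo_map g hγ) hc hb q hq
    exact key u (by linarith [dist_triangle p q u]) (Or.inr hu)

/-- If the displacement of `p` is large, moving along `[p, g p]` reduces it. -/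
theorem disp_reduce {X : Type} [MetricSpace X] (δ : ℝ) (hδ : 0 < δ)
    (hgeo : IsGeodesicSpace X) (hhyp : IsDeltaHyperbolic X δ) (g : X ≃ᵢ X) {p q : X}
    (hpq : dist q (g q) + 900 * δ < dist p (g p)) :
    ∃ a, dist p a ≤ 100 * δ ∧ dist (g a) a ≤ dist (g p) p - 196 * δ := by
  obtain ⟨γ, hγ⟩ := hgeo p (g p)
  obtain ⟨η, hη⟩ := hgeo (g p) (g q)
  obtain ⟨η', hη', hsub⟩ := geo_rev hη
  obtain ⟨α, hα⟩ := hgeo p (g q)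
  obtain ⟨β, hβ⟩ := hgeo (g q) (g (g p))
  have hq0 : 0 ≤ dist q (g q) := dist_nonneg
  have hr : 100 * δ ∈ Set.Icc (0 : ℝ) (dist p (g p)) := ⟨by linarith, by linarith⟩
  have hr' : dist p (g p) - 100 * δ ∈ Set.Icc (0 : ℝ) (dist p (g p)) :=
    ⟨by linarith, by linarith⟩
  have hd1 : dist p (γ (100 * δ)) = 100 * δ := by
    have h := hγ.2.2 0 ⟨le_refl _, dist_nonneg⟩ _ hr
    rw [hγ.1] at h
    rw [h, abs_of_nonpos (by linarith)]
    ring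
  have hd2 : dist (γ (100 * δ)) (γ (dist p (g p) - 100 * δ)) = dist p (g p) - 200 * δ := by
    rw [hγ.2.2 _ hr _ hr', abs_of_nonpos (by linarith)]
    ring
  have hm : γ (100 * δ) ∈ geoImage p (g p) γ := ⟨_, hr, rfl⟩
  have hm' : γ (dist p (g p) - 100 * δ) ∈ geoImage p (g p) γ := ⟨_, hr', rfl⟩
  have hd3 : dist p (γ (dist p (g p) - 100 * δ)) = dist p (g p) - 100 * δ := by
    have h := hγ.2.2 0 ⟨le_refl _, dist_nonneg⟩ _ hr'
    rw [hγ.1] at h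
    rw [h, abs_of_nonpos (by linarith)]
    ring
  generalize γ (100 * δ) = a at *
  generalize γ (dist p (g p) - 100 * δ) = c at *
  have hca := geo_add hγ hm'
  have haa := geo_add hγ hm
  refine ⟨a, hd1.le, ?_⟩
  have hD : dist (g p) (g q) = dist p q := g.dist_eq p q
  have hu : ∃ u ∈ geoImage (g p) (g q) η, dist c u ≤ δ := by
    obtain ⟨u, hu, hcu⟩ := hhyp p (g q) (g p) α η' γ hα hη' hγ c hm'
    rcases hu with hu | hu
    · exfalso
      have h1 := geo_add hα hu
      have h2 := dist_triangle p q (g q)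
      have h3 := dist_triangle4 (g p) c u (g q)
      have h4 := dist_triangle p u c
      rw [dist_comm u c] at h4
      rw [dist_comm (g p) c] at h3
      linarith
    · exact ⟨u, hsub hu, hcu⟩
  have hv : ∃ v ∈ geoImage (g p) (g q) η, dist (g a) v ≤ δ := by
    obtain ⟨v, hv, hav⟩ := hhyp (g p) (g q) (g (g p)) η β _ hη hβ (geo_map g hγ) (g a)
      (geo_map_mem g hm)
    rcases hv with hv | hv
    · exact ⟨v, hv, hav⟩
    · exfalso
      have h1 := geo_add hβ hv
      have h2 := dist_triangle q (g q) (g p)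
      have h3 := dist_triangle4 (g p) (g a) v (g q)
      have h4 := dist_triangle (g a) v (g (g p))
      rw [g.dist_eq] at h1 h3 h4
      rw [dist_comm (g q) (g p)] at h2
      rw [dist_comm v (g q)] at h3
      have h5 := g.dist_eq p a
      linarith
  obtain ⟨u, hu, hcu⟩ := hu
  obtain ⟨v, hv, hav⟩ := hv
  have huv := geo_dist hη hu hv
  have h1 := dist_triangle (g p) c u
  have h2 := dist_triangle (g p) u c
  have h3 := dist_triangle (g p) (g a) v
  have h4 := dist_triangle (g p) v (g a)
  rw [g.dist_eq] at h3 h4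
  rw [dist_comm (g p) c] at h1 h2
  rw [dist_comm u c] at h2
  rw [dist_comm v (g a)] at h4
  have h5 : dist u v ≤ 2 * δ := by
    rw [huv, abs_le]
    constructor <;> linarith
  have h6 := dist_triangle4 (g a) v u c
  have h7 := dist_triangle (g a) c a
  rw [dist_comm v u, dist_comm u c] at h6
  rw [dist_comm c a] at h7
  rw [dist_comm (g p) p]
  linarith

theorem minSet_nonempty_invariant_quasiconvex
    {X : Type} [MetricSpace X] [Nonempty X] (δ : ℝ) (hδ : 0 < δ)
    (hgeo : IsGeodesicSpace X) (hhyp : IsDeltaHyperbolic X δ)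
    (g : X ≃ᵢ X) :
    (minSet δ g).Nonempty ∧
    (g : X → X) '' minSet δ g = minSet δ g ∧
    QuasiConvexSet (100 * δ) (minSet δ g) := by
  obtain ⟨q, hq⟩ : ∃ q, dist q (g q) < minTrans g + δ :=
    exists_lt_of_ciInf_lt (show (⨅ p : X, dist p (g p)) < minTrans g + δ by
      change minTrans g < _
      linarith)
  refine ⟨⟨q, ?_⟩, ?_, ?_⟩
  · change dist (g q) q ≤ _
    rw [dist_comm]
    linarith
  · ext x
    constructor
    · rintro ⟨y, hy, rfl⟩
      change dist (g (g y)) (g y) ≤ _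
      rw [g.dist_eq]
      exact hy
    · intro hx
      refine ⟨g.symm x, ?_, g.apply_symm_apply x⟩
      change dist (g (g.symm x)) (g.symm x) ≤ _
      rw [← g.dist_eq, g.apply_symm_apply]
      exact hx
  · intro x hx y hy γ hγ p hp
    by_cases hpm : p ∈ minSet δ g
    · exact ⟨p, hpm, by rw [dist_self]; linarith⟩
    · have h1 : minTrans g + 1000 * δ < dist (g p) p := not_le.mp hpm
      have h2 := disp_quasiconvex δ hδ hgeo hhyp g hx hy hγ hp
      obtain ⟨a, ha, hga⟩ := disp_reduce δ hδ hgeo hhyp g (p := p) (q := q)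
        (by rw [dist_comm p]; linarith)
      refine ⟨a, ?_, ha⟩
      change dist (g a) a ≤ _
      linarith
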